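/- arXiv:2210.15335 — 5 statements merged into one kernel-verified Lean document; each statement's English description precedes it below -/
import Mathlib

section
/- Let R ≅ R1 × R2 × ⋯ × Rn with n ≥ 4, where each Ri is a local commutative ring with unity and maximal ideal Mi. Then the four nonzero proper ideals I1 = M1 × R2 × R3 × ⋯ × Rn, I2 = M1 × M2 × R3 × ⋯ × Rn, I3 = R1 × R2 × M3 × R4 × ⋯ × Rn, and I4 = R1 × R2 × M3 × M4 × R5 × ⋯ × Rn are pairwise distinct and induce a subgraph of the prime ideal sum graph PIS(R) isomorphic to 2K2: the only adjacencies among them are I1 ~ I2 and I3 ~ I4. -/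
open IsLocalRing

/-- The ideal of the product ring `∀ i, Rs i` consisting of the functions whose
`i`-th coordinate lies in `J` (and whose other coordinates are arbitrary), i.e. the
product ideal `R₁ × ⋯ × J × ⋯ × Rₙ`. -/
def coordIdeal {n : ℕ} (Rs : Fin n → Type*) [∀ i, CommRing (Rs i)]
    (i : Fin n) (J : Ideal (Rs i)) : Ideal (∀ i, Rs i) :=
  Ideal.comap (Pi.evalRingHom Rs i) J

section

variable {n : ℕ} {Rs : Fin n → Type*} [∀ i, CommRing (Rs i)]

theorem single_one_mem_coordIdeal {i j : Fin n} (hij : i ≠ j) (J : Ideal (Rs j)) :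
    Pi.single i 1 ∈ coordIdeal Rs j J := by
  simp [coordIdeal, Ideal.mem_comap, Pi.single_eq_of_ne hij.symm]

theorem single_one_ne_zero [∀ i, Nontrivial (Rs i)] (i : Fin n) :
    (Pi.single i 1 : ∀ i, Rs i) ≠ 0 := by
  simp

theorem isCoprime_coordIdeal {i j : Fin n} (hij : i ≠ j) (I : Ideal (Rs i)) (J : Ideal (Rs j)) :
    IsCoprime (coordIdeal Rs i I) (coordIdeal Rs j J) := by
  refine Ideal.isCoprime_iff_exists.mpr
    ⟨1 - Pi.single i 1, ?_, Pi.single i 1, single_one_mem_coordIdeal hij J, sub_add_cancel _ _⟩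
  simp [coordIdeal, Ideal.mem_comap]

theorem IsCoprime.ideal_inf_right {A : Type*} [CommRing A] {I J K : Ideal A}
    (hJ : IsCoprime I J) (hK : IsCoprime I K) : IsCoprime I (J ⊓ K) := by
  rw [Ideal.isCoprime_iff_sup_eq, eq_top_iff, ← Ideal.isCoprime_iff_sup_eq.mp (hJ.mul_right hK)]
  exact sup_le_sup_left Ideal.mul_le_inf I

theorem IsCoprime.ideal_ne {A : Type*} [CommRing A] {I J : Ideal A}
    (h : IsCoprime I J) (hI : I ≠ ⊤) : I ≠ J := by
  rintro rfl
  exact hI (by simpa using Ideal.isCoprime_iff_sup_eq.mp h)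

theorem IsCoprime.not_isPrime_sup {A : Type*} [CommRing A] {I J : Ideal A}
    (h : IsCoprime I J) : ¬ (I ⊔ J).IsPrime :=
  fun hp ↦ hp.ne_top (Ideal.isCoprime_iff_sup_eq.mp h)

instance isPrime_coordIdeal (i : Fin n) (J : Ideal (Rs i)) [J.IsPrime] :
    (coordIdeal Rs i J).IsPrime :=
  Ideal.comap_isPrime _ _

theorem coordIdeal_inf_ne_bot [∀ i, Nontrivial (Rs i)] {i j k : Fin n} (hi : k ≠ i) (hj : k ≠ j)
    (I : Ideal (Rs i)) (J : Ideal (Rs j)) : coordIdeal Rs i I ⊓ coordIdeal Rs j J ≠ ⊥ :=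
  (Submodule.ne_bot_iff _).mpr ⟨_,
    ⟨single_one_mem_coordIdeal hi I, single_one_mem_coordIdeal hj J⟩, single_one_ne_zero k⟩

theorem coordIdeal_ne_inf {i j : Fin n} (hij : i ≠ j)
    {I : Ideal (Rs i)} {J : Ideal (Rs j)} (hJ : coordIdeal Rs j J ≠ ⊤) :
    coordIdeal Rs i I ≠ coordIdeal Rs i I ⊓ coordIdeal Rs j J := fun h ↦
  hJ <| by
    rw [← sup_eq_right.mpr (left_eq_inf.mp h)]
    exact Ideal.isCoprime_iff_sup_eq.mp (isCoprime_coordIdeal hij I J)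

end

/-- For `R ≅ R₁ × ⋯ × Rₙ` (`n ≥ 4`) with each `Rᵢ` local, the ideals
`I₁ = M₁ × R₂ × ⋯ × Rₙ`, `I₂ = M₁ × M₂ × R₃ × ⋯ × Rₙ`,
`I₃ = R₁ × R₂ × M₃ × R₄ × ⋯ × Rₙ` and `I₄ = R₁ × R₂ × M₃ × M₄ × R₅ × ⋯ × Rₙ`
are pairwise distinct nonzero proper ideals inducing a `2K₂` in `PIS(R)`:
the only adjacencies among them are `I₁ ~ I₂` and `I₃ ~ I₄`. -/
theorem pis_induced_twoK2_of_four_le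
    (n : ℕ) (hn : 4 ≤ n) (Rs : Fin n → Type*)
    [∀ i, CommRing (Rs i)] [∀ i, IsLocalRing (Rs i)] :
    let I₁ := coordIdeal Rs ⟨0, by omega⟩ (maximalIdeal _)
    let I₂ := I₁ ⊓ coordIdeal Rs ⟨1, by omega⟩ (maximalIdeal _)
    let I₃ := coordIdeal Rs ⟨2, by omega⟩ (maximalIdeal _)
    let I₄ := I₃ ⊓ coordIdeal Rs ⟨3, by omega⟩ (maximalIdeal _)
    (I₁ ≠ ⊥ ∧ I₁ ≠ ⊤) ∧ (I₂ ≠ ⊥ ∧ I₂ ≠ ⊤) ∧ (I₃ ≠ ⊥ ∧ I₃ ≠ ⊤) ∧ (I₄ ≠ ⊥ ∧ I₄ ≠ ⊤) ∧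
    (I₁ ≠ I₂ ∧ I₁ ≠ I₃ ∧ I₁ ≠ I₄ ∧ I₂ ≠ I₃ ∧ I₂ ≠ I₄ ∧ I₃ ≠ I₄) ∧
    (I₁ ⊔ I₂).IsPrime ∧ (I₃ ⊔ I₄).IsPrime ∧
    ¬ (I₁ ⊔ I₃).IsPrime ∧ ¬ (I₁ ⊔ I₄).IsPrime ∧
    ¬ (I₂ ⊔ I₃).IsPrime ∧ ¬ (I₂ ⊔ I₄).IsPrime := by
  intro I₁ I₂ I₃ I₄
  have h₁ : I₁ ≠ ⊤ := Ideal.IsPrime.ne_top (isPrime_coordIdeal _ _)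
  have h₃ : I₃ ≠ ⊤ := Ideal.IsPrime.ne_top (isPrime_coordIdeal _ _)
  have h₂ : I₂ ≠ ⊤ := ne_top_of_le_ne_top h₁ inf_le_left
  have h₄ : I₄ ≠ ⊤ := ne_top_of_le_ne_top h₃ inf_le_left
  have b₂ : I₂ ≠ ⊥ := coordIdeal_inf_ne_bot (k := ⟨2, by omega⟩) (by simp) (by simp) _ _
  have b₄ : I₄ ≠ ⊥ := coordIdeal_inf_ne_bot (k := ⟨0, by omega⟩) (by simp) (by simp) _ _
  have b₁ : I₁ ≠ ⊥ := ne_bot_of_le_ne_bot b₂ inf_le_left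
  have b₃ : I₃ ≠ ⊥ := ne_bot_of_le_ne_bot b₄ inf_le_left
  have c₁₃ : IsCoprime I₁ I₃ := isCoprime_coordIdeal (by simp) _ _
  have c₁₄ : IsCoprime I₁ I₄ := c₁₃.ideal_inf_right (isCoprime_coordIdeal (by simp) _ _)
  have c₂₃ : IsCoprime I₂ I₃ :=
    (c₁₃.symm.ideal_inf_right (isCoprime_coordIdeal (by simp) _ _)).symm
  have c₂₄ : IsCoprime I₂ I₄ :=
    (c₁₄.symm.ideal_inf_right
      ((isCoprime_coordIdeal (by simp) _ _).ideal_inf_right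
        (isCoprime_coordIdeal (by simp) _ _)).symm).symm
  refine ⟨⟨b₁, h₁⟩, ⟨b₂, h₂⟩, ⟨b₃, h₃⟩, ⟨b₄, h₄⟩,
    ⟨coordIdeal_ne_inf (by simp) (Ideal.IsPrime.ne_top (isPrime_coordIdeal _ _)),
      c₁₃.ideal_ne h₁, c₁₄.ideal_ne h₁, c₂₃.ideal_ne h₂, c₂₄.ideal_ne h₂,
      coordIdeal_ne_inf (by simp) (Ideal.IsPrime.ne_top (isPrime_coordIdeal _ _))⟩,
    ?_, ?_, c₁₃.not_isPrime_sup, c₁₄.not_isPrime_sup, c₂₃.not_isPrime_sup, c₂₄.not_isPrime_sup⟩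
  · rw [sup_inf_self]
    exact isPrime_coordIdeal _ _
  · rw [sup_inf_self]
    exact isPrime_coordIdeal _ _
end

section
/- Let R ≅ R1 × R2 × ⋯ × Rn with n ≥ 3, where each Ri is a local commutative ring with unity and maximal ideal Mi. Then the four nonzero proper ideals A = M1 × R2 × R3 × R4 × ⋯ × Rn, B = M1 × R2 × M3 × R4 × ⋯ × Rn, C = R1 × M2 × M3 × R4 × ⋯ × Rn, and D = R1 × M2 × R3 × R4 × ⋯ × Rn are pairwise distinct and induce a subgraph of the prime ideal sum graph PIS(R) isomorphic to the path P4: the only adjacencies among them are A ~ B, B ~ C, and C ~ D. -/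
open IsLocalRing

section coordIdeal

variable {n : ℕ} {Rs : Fin n → Type*} [∀ i, CommRing (Rs i)]

theorem mem_coordIdeal {i : Fin n} {J : Ideal (Rs i)} {x : ∀ i, Rs i} :
    x ∈ coordIdeal Rs i J ↔ x i ∈ J := Iff.rfl

theorem coordIdeal_isPrime {i : Fin n} {J : Ideal (Rs i)} (hJ : J.IsPrime) :
    (coordIdeal Rs i J).IsPrime :=
  Ideal.comap_isPrime _ J

theorem single_one_mem_coordIdeal_iff {i j : Fin n} {J : Ideal (Rs i)} (hJ : J ≠ ⊤) :
    Pi.single j 1 ∈ coordIdeal Rs i J ↔ i ≠ j := by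
  rw [mem_coordIdeal]
  obtain rfl | h := eq_or_ne i j
  · simpa using (Ideal.ne_top_iff_one J).mp hJ
  · simp [h]

theorem coordIdeal_sup_eq_top {i : Fin n} (J : Ideal (Rs i)) {I : Ideal (∀ i, Rs i)}
    (h : Pi.single i 1 ∈ I) : coordIdeal Rs i J ⊔ I = ⊤ := by
  rw [Ideal.eq_top_iff_one, ← sub_add_cancel 1 (Pi.single i (1 : Rs i))]
  exact Submodule.add_mem_sup (by simp [mem_coordIdeal]) h

theorem inf_sup_coordIdeal_inf {i j : Fin n} (hij : i ≠ j) (J : Ideal (Rs i))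
    (K : Ideal (Rs j)) (L : Ideal (∀ i, Rs i)) :
    coordIdeal Rs i J ⊓ L ⊔ coordIdeal Rs j K ⊓ L = L := by
  refine le_antisymm (sup_le inf_le_right inf_le_right) fun x hx => ?_
  rw [← sub_add_cancel x (x * Pi.single i (1 : Rs i))]
  have hxi : x * Pi.single i (1 : Rs i) ∈ L := L.mul_mem_right _ hx
  exact Submodule.add_mem_sup ⟨by simp [mem_coordIdeal], L.sub_mem hx hxi⟩
    ⟨by simp [mem_coordIdeal, hij.symm], hxi⟩

end coordIdeal

/-- For `R ≅ R₁ × ⋯ × Rₙ` (`n ≥ 3`) with each `Rᵢ` local, the ideals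
`A = M₁ × R₂ × R₃ × ⋯ × Rₙ`, `B = M₁ × R₂ × M₃ × R₄ × ⋯ × Rₙ`,
`C = R₁ × M₂ × M₃ × R₄ × ⋯ × Rₙ` and `D = R₁ × M₂ × R₃ × ⋯ × Rₙ`
are pairwise distinct nonzero proper ideals inducing a path `P₄` in `PIS(R)`:
the only adjacencies among them are `A ~ B`, `B ~ C` and `C ~ D`. -/
theorem pis_induced_path4_of_three_le
    (n : ℕ) (hn : 3 ≤ n) (Rs : Fin n → Type*)
    [∀ i, CommRing (Rs i)] [∀ i, IsLocalRing (Rs i)] :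
    let A := coordIdeal Rs ⟨0, by omega⟩ (maximalIdeal _)
    let B := A ⊓ coordIdeal Rs ⟨2, by omega⟩ (maximalIdeal _)
    let D := coordIdeal Rs ⟨1, by omega⟩ (maximalIdeal _)
    let C := D ⊓ coordIdeal Rs ⟨2, by omega⟩ (maximalIdeal _)
    (A ≠ ⊥ ∧ A ≠ ⊤) ∧ (B ≠ ⊥ ∧ B ≠ ⊤) ∧ (C ≠ ⊥ ∧ C ≠ ⊤) ∧ (D ≠ ⊥ ∧ D ≠ ⊤) ∧
    (A ≠ B ∧ A ≠ C ∧ A ≠ D ∧ B ≠ C ∧ B ≠ D ∧ C ≠ D) ∧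
    (A ⊔ B).IsPrime ∧ (B ⊔ C).IsPrime ∧ (C ⊔ D).IsPrime ∧
    ¬ (A ⊔ C).IsPrime ∧ ¬ (A ⊔ D).IsPrime ∧ ¬ (B ⊔ D).IsPrime := by
  intro A B D C
  have ne_bot {I : Ideal (∀ i, Rs i)} (i : Fin n) (h : Pi.single i 1 ∈ I) : I ≠ ⊥ := by
    rintro rfl
    simp at h
  have ne_top {I : Ideal (∀ i, Rs i)} (i : Fin n) (h : Pi.single i 1 ∉ I) : I ≠ ⊤ := by
    rintro rfl
    exact h trivial
  have ne_of_mem {I J : Ideal (∀ i, Rs i)} (i : Fin n) (h : Pi.single i 1 ∈ I)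
      (h' : Pi.single i 1 ∉ J) : I ≠ J := by
    rintro rfl
    exact h' h
  have hmax (i : Fin n) : (maximalIdeal (Rs i)).IsPrime := inferInstance
  have hA (j : Fin n) : Pi.single j 1 ∈ A ↔ j.val ≠ 0 := by
    simp only [A, single_one_mem_coordIdeal_iff (hmax _).ne_top, ne_eq, Fin.ext_iff]
    omega
  have hB (j : Fin n) : Pi.single j 1 ∈ B ↔ j.val ≠ 0 ∧ j.val ≠ 2 := by
    simp only [B, Submodule.mem_inf, hA, single_one_mem_coordIdeal_iff (hmax _).ne_top, ne_eq,
      Fin.ext_iff]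
    omega
  have hD (j : Fin n) : Pi.single j 1 ∈ D ↔ j.val ≠ 1 := by
    simp only [D, single_one_mem_coordIdeal_iff (hmax _).ne_top, ne_eq, Fin.ext_iff]
    omega
  have hC (j : Fin n) : Pi.single j 1 ∈ C ↔ j.val ≠ 1 ∧ j.val ≠ 2 := by
    simp only [C, Submodule.mem_inf, hD, single_one_mem_coordIdeal_iff (hmax _).ne_top, ne_eq,
      Fin.ext_iff]
    omega
  let i₀ : Fin n := ⟨0, by omega⟩
  let i₁ : Fin n := ⟨1, by omega⟩
  let i₂ : Fin n := ⟨2, by omega⟩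
  have hAB : (A ⊔ B).IsPrime := by
    rw [sup_eq_left.mpr (inf_le_left : B ≤ A)]
    exact coordIdeal_isPrime (hmax _)
  have hBC : (B ⊔ C).IsPrime := by
    rw [inf_sup_coordIdeal_inf (by simp)]
    exact coordIdeal_isPrime (hmax _)
  have hCD : (C ⊔ D).IsPrime := by
    rw [sup_eq_right.mpr (inf_le_left : C ≤ D)]
    exact coordIdeal_isPrime (hmax _)
  have hAC : ¬ (A ⊔ C).IsPrime := fun h =>
    h.ne_top (coordIdeal_sup_eq_top _ ((hC _).mpr (by simp)))
  have hAD : ¬ (A ⊔ D).IsPrime := fun h =>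
    h.ne_top (coordIdeal_sup_eq_top _ ((hD _).mpr (by simp)))
  have hBD : ¬ (B ⊔ D).IsPrime := fun h =>
    h.ne_top (sup_comm B D ▸ coordIdeal_sup_eq_top _ ((hB _).mpr (by simp)))
  refine ⟨⟨ne_bot i₁ ?_, ne_top i₀ ?_⟩, ⟨ne_bot i₁ ?_, ne_top i₀ ?_⟩,
    ⟨ne_bot i₀ ?_, ne_top i₁ ?_⟩, ⟨ne_bot i₀ ?_, ne_top i₁ ?_⟩,
    ⟨ne_of_mem i₂ ?_ ?_, ne_of_mem i₁ ?_ ?_, ne_of_mem i₁ ?_ ?_, ne_of_mem i₁ ?_ ?_,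
      ne_of_mem i₁ ?_ ?_, (ne_of_mem i₂ ?_ ?_).symm⟩,
    hAB, hBC, hCD, hAC, hAD, hBD⟩
  all_goals simp [hA, hB, hC, hD, i₀, i₁, i₂]
end

section
/- Let R ≅ R1 × R2, where R1 and R2 are local commutative rings with unity and nonzero maximal ideals M1 and M2 (i.e., neither R1 nor R2 is a field). Then the four nonzero proper ideals M1 × R2, (0) × R2, R1 × M2, and R1 × (0) are pairwise distinct and induce a subgraph of the prime ideal sum graph PIS(R) isomorphic to 2K2: the only adjacencies among them are M1 × R2 ~ (0) × R2 and R1 × M2 ~ R1 × (0). -/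
open IsLocalRing

/-- The sum of product ideals is the product of the sums. -/
theorem Ideal.prod_sup_prod {R S : Type*} [Semiring R] [Semiring S]
    (I I' : Ideal R) (J J' : Ideal S) :
    I.prod J ⊔ I'.prod J' = (I ⊔ I').prod (J ⊔ J') :=
  ((Ideal.idealProdEquiv (R := R) (S := S)).symm.map_sup (I, J) (I', J')).symm

/-- For `R ≅ R₁ × R₂` with `R₁, R₂` local rings that are not fields (their maximal
ideals are nonzero), the four ideals `M₁ × R₂`, `(0) × R₂`, `R₁ × M₂` and `R₁ × (0)`
are pairwise distinct nonzero proper ideals inducing a `2K₂` in `PIS(R₁ × R₂)`: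
the only adjacencies among them are `M₁ × R₂ ~ (0) × R₂` and `R₁ × M₂ ~ R₁ × (0)`. -/
theorem pis_induced_twoK2_of_not_fields
    (R₁ R₂ : Type*) [CommRing R₁] [CommRing R₂] [IsLocalRing R₁] [IsLocalRing R₂]
    (h₁ : maximalIdeal R₁ ≠ ⊥) (h₂ : maximalIdeal R₂ ≠ ⊥) :
    let A : Ideal (R₁ × R₂) := (maximalIdeal R₁).prod ⊤
    let B : Ideal (R₁ × R₂) := (⊥ : Ideal R₁).prod ⊤
    let C : Ideal (R₁ × R₂) := (⊤ : Ideal R₁).prod (maximalIdeal R₂)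
    let D : Ideal (R₁ × R₂) := (⊤ : Ideal R₁).prod ⊥
    (A ≠ ⊥ ∧ A ≠ ⊤) ∧ (B ≠ ⊥ ∧ B ≠ ⊤) ∧ (C ≠ ⊥ ∧ C ≠ ⊤) ∧ (D ≠ ⊥ ∧ D ≠ ⊤) ∧
    (A ≠ B ∧ A ≠ C ∧ A ≠ D ∧ B ≠ C ∧ B ≠ D ∧ C ≠ D) ∧
    (A ⊔ B).IsPrime ∧ (C ⊔ D).IsPrime ∧
    ¬ (A ⊔ C).IsPrime ∧ ¬ (A ⊔ D).IsPrime ∧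
    ¬ (B ⊔ C).IsPrime ∧ ¬ (B ⊔ D).IsPrime := by
  intro A B C D
  have m₁ : maximalIdeal R₁ ≠ ⊤ := (maximalIdeal.isMaximal R₁).ne_top
  have m₂ : maximalIdeal R₂ ≠ ⊤ := (maximalIdeal.isMaximal R₂).ne_top
  have hAB : (A ⊔ B).IsPrime := by
    simpa [A, B, Ideal.prod_sup_prod] using
      Ideal.isPrime_ideal_prod_top (S := R₂) (I := maximalIdeal R₁)
  have hCD : (C ⊔ D).IsPrime := by
    simpa [C, D, Ideal.prod_sup_prod] using
      Ideal.isPrime_ideal_prod_top' (R := R₁) (I := maximalIdeal R₂)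
  have not_prime {I : Ideal R₁} {J : Ideal R₂} : ¬ (I.prod ⊤ ⊔ Ideal.prod ⊤ J).IsPrime := by
    intro h
    exact h.ne_top (by simp [Ideal.prod_sup_prod])
  refine ⟨?_, ?_, ?_, ?_, ?_, hAB, hCD, not_prime, not_prime, not_prime, not_prime⟩ <;>
    simp [A, B, C, D, Ideal.prod_inj, Ideal.prod_eq_bot_iff, Ideal.prod_eq_top_iff,
      h₁, h₂, m₁, m₂]
end

section
/- Let R ≅ F1 × R2, where F1 is a field and R2 is a commutative ring with unity having a maximal ideal M2 and a nonzero ideal I2 with I2 strictly contained in M2, and suppose R2 is local with maximal ideal M2. Then the four nonzero proper ideals F1 × M2, (0) × M2, (0) × R2, and (0) × I2 are pairwise distinct and induce a subgraph of the prime ideal sum graph PIS(R) isomorphic to the 4-cycle C4, with adjacencies F1 × M2 ~ (0) × M2 ~ (0) × R2 ~ (0) × I2 ~ F1 × M2 and no other adjacencies among them. -/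
open IsLocalRing

/-- For `R ≅ F₁ × R₂` with `F₁` a field and `R₂` a local ring with maximal ideal `M₂`
containing a nonzero ideal `I₂` with `I₂ ⊊ M₂`, the four ideals `F₁ × M₂`, `(0) × M₂`,
`(0) × R₂` and `(0) × I₂` are pairwise distinct nonzero proper ideals inducing a
4-cycle `C₄` in `PIS(F₁ × R₂)`, with adjacencies
`F₁ × M₂ ~ (0) × M₂ ~ (0) × R₂ ~ (0) × I₂ ~ F₁ × M₂` and no others among them. -/
theorem pis_induced_C4
    (F₁ R₂ : Type*) [Field F₁] [CommRing R₂] [IsLocalRing R₂]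
    (M₂ : Ideal R₂) (hM₂ : M₂.IsMaximal) (I₂ : Ideal R₂) (hI₂ : I₂ ≠ ⊥)
    (hI₂M₂ : I₂ < M₂) :
    let A : Ideal (F₁ × R₂) := (⊤ : Ideal F₁).prod M₂
    let B : Ideal (F₁ × R₂) := (⊥ : Ideal F₁).prod M₂
    let C : Ideal (F₁ × R₂) := (⊥ : Ideal F₁).prod ⊤
    let D : Ideal (F₁ × R₂) := (⊥ : Ideal F₁).prod I₂
    (A ≠ ⊥ ∧ A ≠ ⊤) ∧ (B ≠ ⊥ ∧ B ≠ ⊤) ∧ (C ≠ ⊥ ∧ C ≠ ⊤) ∧ (D ≠ ⊥ ∧ D ≠ ⊤) ∧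
    (A ≠ B ∧ A ≠ C ∧ A ≠ D ∧ B ≠ C ∧ B ≠ D ∧ C ≠ D) ∧
    (A ⊔ B).IsPrime ∧ (B ⊔ C).IsPrime ∧ (C ⊔ D).IsPrime ∧ (D ⊔ A).IsPrime ∧
    ¬ (A ⊔ C).IsPrime ∧ ¬ (B ⊔ D).IsPrime := by
  intro A B C D
  have hM_bot : M₂ ≠ ⊥ := (bot_le.trans_lt hI₂M₂).ne'
  have hM_top : M₂ ≠ ⊤ := hM₂.ne_top
  have hI_top : I₂ ≠ ⊤ := (hI₂M₂.trans_le le_top).ne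
  have hIM : I₂ ≠ M₂ := hI₂M₂.ne
  have hbot_top : (⊥ : Ideal F₁) ≠ ⊤ := bot_ne_top
  have hM_prime : M₂.IsPrime := hM₂.isPrime
  have hA : A.IsPrime := Ideal.isPrime_ideal_prod_top'
  have hC : C.IsPrime := Ideal.isPrime_ideal_prod_top
  have hAB : A ⊔ B = A := sup_eq_left.2 (Ideal.prod_mono_left bot_le)
  have hBC : B ⊔ C = C := sup_eq_right.2 (Ideal.prod_mono_right le_top)
  have hCD : C ⊔ D = C := sup_eq_left.2 (Ideal.prod_mono_right le_top)
  have hDA : D ⊔ A = A := sup_eq_right.2 (Ideal.prod_mono bot_le hI₂M₂.le)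
  have hBD : B ⊔ D = B := sup_eq_left.2 (Ideal.prod_mono_right hI₂M₂.le)
  have hAC : A ⊔ C = ⊤ := by
    rw [Ideal.eq_top_iff_one]
    have h₁ : ((1, 0) : F₁ × R₂) ∈ A := by simp [A]
    have h₂ : ((0, 1) : F₁ × R₂) ∈ C := by simp [C]
    simpa [← Prod.one_eq_mk] using Submodule.add_mem_sup h₁ h₂
  rw [hAB, hBC, hCD, hDA, hBD, hAC]
  refine ⟨?_, ?_, ?_, ?_, ?_, hA, hC, hC, hA, fun h => h.ne_top rfl, fun h => ?_⟩
  · simp [A, hM_top]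
  · simp [B, hM_bot]
  · simp [C]
  · simp [D, hI₂]
  · simp [A, B, C, D, Ideal.prod_inj, hM_top, hI_top.symm, hIM.symm]
  · exact (Ideal.ideal_prod_prime_aux h).elim hbot_top hM_top
end

section
/- Let R ≅ F1 × R2, where F1 is a field and R2 is a local commutative ring with unity whose unique nonzero proper ideal is its maximal ideal M2. Then the prime ideal sum graph PIS(R) has exactly four vertices, namely (0) × M2, (0) × R2, F1 × (0), and F1 × M2, and its edges are exactly the following four: (0) × M2 ~ F1 × (0), (0) × M2 ~ F1 × M2, F1 × (0) ~ F1 × M2, and (0) × M2 ~ (0) × R2. In particular, the three vertices (0) × M2, F1 × (0), F1 × M2 form a triangle and (0) × R2 is adjacent only to (0) × M2. -/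
open IsLocalRing

/-- For `R ≅ F₁ × R₂` with `F₁` a field and `R₂` a local ring whose unique nonzero
proper ideal is its maximal ideal `M₂`, the graph `PIS(R)` has exactly the four
vertices `(0) × M₂`, `(0) × R₂`, `F₁ × (0)`, `F₁ × M₂`, and its edges are exactly
`(0) × M₂ ~ F₁ × (0)`, `(0) × M₂ ~ F₁ × M₂`, `F₁ × (0) ~ F₁ × M₂` and
`(0) × M₂ ~ (0) × R₂`; in particular `(0) × M₂, F₁ × (0), F₁ × M₂` form a triangle
and `(0) × R₂` is adjacent only to `(0) × M₂`. -/
theorem pis_field_times_unique_ideal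
    (F₁ R₂ : Type*) [Field F₁] [CommRing R₂] [IsLocalRing R₂]
    (huniq : ∀ I : Ideal R₂, (I ≠ ⊥ ∧ I ≠ ⊤) ↔ I = maximalIdeal R₂) :
    let A : Ideal (F₁ × R₂) := (⊥ : Ideal F₁).prod (maximalIdeal R₂)
    let B : Ideal (F₁ × R₂) := (⊥ : Ideal F₁).prod ⊤
    let C : Ideal (F₁ × R₂) := (⊤ : Ideal F₁).prod ⊥
    let D : Ideal (F₁ × R₂) := (⊤ : Ideal F₁).prod (maximalIdeal R₂)
    ({I : Ideal (F₁ × R₂) | I ≠ ⊥ ∧ I ≠ ⊤} = {A, B, C, D}) ∧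
    (A ≠ B ∧ A ≠ C ∧ A ≠ D ∧ B ≠ C ∧ B ≠ D ∧ C ≠ D) ∧
    (A ⊔ C).IsPrime ∧ (A ⊔ D).IsPrime ∧ (C ⊔ D).IsPrime ∧ (A ⊔ B).IsPrime ∧
    ¬ (B ⊔ C).IsPrime ∧ ¬ (B ⊔ D).IsPrime := by
  intro A B C D
  obtain ⟨hbot, htop⟩ := (huniq (maximalIdeal R₂)).mpr rfl
  have hD : D.IsPrime := Ideal.isPrime_ideal_prod_top'
  refine ⟨?_, ?_, ?_, ?_, ?_, ?_, ?_, ?_⟩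
  · ext I
    rw [Ideal.ideal_prod_eq I]
    generalize I.map (RingHom.fst F₁ R₂) = J
    generalize I.map (RingHom.snd F₁ R₂) = K
    simp only [Set.mem_ofPred_eq, Set.mem_insert_iff, Set.mem_singleton_iff, A, B, C, D,
      Ideal.prod_inj, ne_eq, Ideal.prod_eq_bot_iff, Ideal.prod_eq_top_iff]
    have hJ := Ideal.eq_bot_or_top J
    have hK := huniq K
    have hF' : (⊥ : Ideal F₁) ≠ ⊤ := bot_ne_top
    have hR : (⊥ : Ideal R₂) ≠ ⊤ := bot_ne_top
    grind
  · simp [A, B, C, D, Ideal.prod_inj, hbot, htop, Ne.symm hbot, Ne.symm htop]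
  · simpa [A, C, D, Ideal.prod_sup_prod] using hD
  · simpa [A, D, Ideal.prod_sup_prod] using hD
  · simpa [C, D, Ideal.prod_sup_prod] using hD
  · simpa [A, B, Ideal.prod_sup_prod] using
      Ideal.isPrime_ideal_prod_top (I := (⊥ : Ideal F₁)) (S := R₂)
  · simpa [B, C, Ideal.prod_sup_prod] using fun h : (⊤ : Ideal (F₁ × R₂)).IsPrime => h.ne_top rfl
  · simpa [B, D, Ideal.prod_sup_prod] using fun h : (⊤ : Ideal (F₁ × R₂)).IsPrime => h.ne_top rfl
end
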